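/- The sequence A →∂₂ V ⊗[ℚ] A →∂₁ A is exact: the kernel of ∂₁ equals the range of ∂₂, where ∂₂(u) = Σ_{j=1}^{g} ( a_j ⊗ ι(b_j)·u − b_j ⊗ ι(a_j)·u ) and ∂₁(x ⊗ v) = ι(x)·v. (Note ∂₁∘∂₂ = 0 since the image of θ in A is zero.) -/

import Mathlib

/-!
Context: `V g` is the ℚ-vector space with basis `a₁,…,a_g, b₁,…,b_g`;
`θ g := Σ_j (a_j·b_j − b_j·a_j)` in the tensor algebra `T(V g)`;
`A g` is the quotient of `T(V g)` by the two-sided ideal generated by `θ g`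
(realized as `RingQuot` of the relation identifying `θ g` with `0`), with quotient
map `piA g` and `iotaA g : V g →ₗ[ℚ] A g` the composite of the canonical map with `piA g`.
-/

open scoped TensorProduct

noncomputable section

/-- The ℚ-vector space with basis indexed by `Fin g ⊕ Fin g`. -/
abbrev V (g : ℕ) : Type := (Fin g ⊕ Fin g) → ℚ

/-- The basis vector `a_j`. -/
def aV (g : ℕ) (j : Fin g) : V g := Pi.single (Sum.inl j) 1

/-- The basis vector `b_j`. -/
def bV (g : ℕ) (j : Fin g) : V g := Pi.single (Sum.inr j) 1

/-- The element `θ = Σ_j (a_j b_j − b_j a_j)` of the tensor algebra `T(V)`. -/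
def theta (g : ℕ) : TensorAlgebra ℚ (V g) :=
  ∑ j : Fin g,
    (TensorAlgebra.ι ℚ (aV g j) * TensorAlgebra.ι ℚ (bV g j)
      - TensorAlgebra.ι ℚ (bV g j) * TensorAlgebra.ι ℚ (aV g j))

/-- The relation identifying `θ` with `0`; quotienting by it is quotienting by the
two-sided ideal generated by `θ`. -/
def Arel (g : ℕ) : TensorAlgebra ℚ (V g) → TensorAlgebra ℚ (V g) → Prop :=
  fun x y => x = theta g ∧ y = 0

/-- `A := T(V)/(θ)`. -/
abbrev A (g : ℕ) : Type := RingQuot (Arel g)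

/-- The quotient map `π : T(V) → A`. -/
def piA (g : ℕ) : TensorAlgebra ℚ (V g) →ₐ[ℚ] A g := RingQuot.mkAlgHom ℚ (Arel g)

/-- `ι : V → A`, the composite of the canonical linear map `V → T(V)` with `π`. -/
def iotaA (g : ℕ) : V g →ₗ[ℚ] A g :=
  (piA g).toLinearMap ∘ₗ TensorAlgebra.ι ℚ

/-- The sequence `A →∂₂ V ⊗ A →∂₁ A` is exact:
`ker ∂₁ = range ∂₂`, where `∂₂(u) = Σ_j (a_j ⊗ ι(b_j)·u − b_j ⊗ ι(a_j)·u)` and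
`∂₁(x ⊗ v) = ι(x)·v`. -/
theorem statement1 (g : ℕ)
    (D2 : A g →ₗ[ℚ] V g ⊗[ℚ] A g)
    (D1 : V g ⊗[ℚ] A g →ₗ[ℚ] A g)
    (hD2 : ∀ u : A g, D2 u =
      ∑ j : Fin g,
        (aV g j ⊗ₜ[ℚ] (iotaA g (bV g j) * u) - bV g j ⊗ₜ[ℚ] (iotaA g (aV g j) * u)))
    (hD1 : ∀ (x : V g) (v : A g), D1 (x ⊗ₜ[ℚ] v) = iotaA g x * v) :
    LinearMap.ker D1 = LinearMap.range D2 := by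
  classical
  have hθ : piA g (theta g) = 0 := by
    have h := RingQuot.mkAlgHom_rel ℚ (s := Arel g) (x := theta g) (y := 0) ⟨rfl, rfl⟩
    rw [map_zero] at h
    exact h
  have hθ' : ∑ j : Fin g, (iotaA g (aV g j) * iotaA g (bV g j)
      - iotaA g (bV g j) * iotaA g (aV g j)) = 0 := by
    rw [← hθ]
    simp [theta, iotaA]
  have hle : LinearMap.range D2 ≤ LinearMap.ker D1 := by
    rintro _ ⟨u, rfl⟩
    rw [LinearMap.mem_ker, hD2, map_sum]
    simp only [map_sub, hD1, ← mul_assoc, ← sub_mul]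
    rw [← Finset.sum_mul, hθ', zero_mul]
  refine le_antisymm ?_ hle
  -- the module `ℚ × (V ⊗ A) / range ∂₂`, its map `φ` to `A`, and the action `E` of `V` on it
  let Q := LinearMap.range D2
  let q : V g ⊗[ℚ] A g →ₗ[ℚ] (V g ⊗[ℚ] A g) ⧸ Q := Q.mkQ
  let d : ((V g ⊗[ℚ] A g) ⧸ Q) →ₗ[ℚ] A g := Q.liftQ D1 hle
  have hd : ∀ w, d (q w) = D1 w := fun w => Submodule.liftQ_apply Q D1 w
  have hq : ∀ u, q (D2 u) = 0 := fun u =>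
    (Submodule.Quotient.mk_eq_zero Q).2 ⟨u, rfl⟩
  let φ : (ℚ × ((V g ⊗[ℚ] A g) ⧸ Q)) →ₗ[ℚ] A g :=
    LinearMap.coprod (Algebra.linearMap ℚ (A g)) d
  let E : V g →ₗ[ℚ] Module.End ℚ (ℚ × ((V g ⊗[ℚ] A g) ⧸ Q)) :=
    LinearMap.mk₂ ℚ (fun x n => ((0 : ℚ), q (x ⊗ₜ[ℚ] φ n)))
      (fun x y n => by simp [TensorProduct.add_tmul])
      (fun c x n => by simp [← TensorProduct.smul_tmul'])
      (fun x m n => by simp only [map_add, TensorProduct.tmul_add, Prod.mk_add_mk, add_zero])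
      (fun c x n => by simp only [map_smul, TensorProduct.tmul_smul, Prod.smul_mk, smul_zero])
  have hE : ∀ x n, E x n = ((0 : ℚ), q (x ⊗ₜ[ℚ] φ n)) := fun x n => rfl
  have hφ : ∀ c m, φ (c, m) = algebraMap ℚ (A g) c + d m := fun c m => rfl
  have hφE : ∀ x n, φ (E x n) = iotaA g x * φ n := fun x n => by
    rw [hE, hφ, hd, hD1, map_zero, zero_add]
  have hEθ : TensorAlgebra.lift ℚ E (theta g) = 0 := by
    refine LinearMap.ext fun n => ?_
    have h1 : ∀ x y : V g, E x (E y n) = LinearMap.inr ℚ ℚ _ (q (x ⊗ₜ[ℚ] (iotaA g y * φ n))) := by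
      intro x y
      rw [hE x, hφE]
      rfl
    simp only [theta, map_sum, map_sub, map_mul, TensorAlgebra.lift_ι_apply, LinearMap.sum_apply,
      LinearMap.sub_apply, Module.End.mul_apply, h1, LinearMap.zero_apply]
    simp only [← map_sub, ← map_sum]
    rw [← hD2, hq, map_zero]
  let F : A g →ₐ[ℚ] Module.End ℚ (ℚ × ((V g ⊗[ℚ] A g) ⧸ Q)) :=
    RingQuot.liftAlgHom ℚ ⟨TensorAlgebra.lift ℚ E, by
      rintro x y ⟨rfl, rfl⟩
      rw [hEθ, map_zero]⟩
  have hF : ∀ t, F (piA g t) = TensorAlgebra.lift ℚ E t := fun t =>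
    RingQuot.liftAlgHom_mkAlgHom_apply _ _ _ _
  have hFι : ∀ x, F (iotaA g x) = E x := fun x => by
    change F (piA g (TensorAlgebra.ι ℚ x)) = _
    rw [hF, TensorAlgebra.lift_ι_apply]
  have hφF : ∀ t n, φ (F (piA g t) n) = piA g t * φ n := by
    intro t
    induction t using TensorAlgebra.induction with
    | algebraMap r => intro n; simp [Algebra.algebraMap_eq_smul_one]
    | ι x => intro n; change φ (F (iotaA g x) n) = iotaA g x * φ n; rw [hFι, hφE]
    | mul a b ha hb => intro n; rw [map_mul, map_mul, Module.End.mul_apply, ha, hb, mul_assoc]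
    | add a b ha hb => intro n; rw [map_add, map_add, LinearMap.add_apply, map_add, ha, hb, add_mul]
  have hsurj : Function.Surjective (piA g) := RingQuot.mkAlgHom_surjective ℚ (Arel g)
  have hs : ∀ w, (F (D1 w) (1, 0)).2 = q w := by
    intro w
    induction w using TensorProduct.induction_on with
    | zero => simp
    | add a b ha hb => rw [map_add, map_add, LinearMap.add_apply, Prod.snd_add, ha, hb, map_add]
    | tmul x v =>
      obtain ⟨t, rfl⟩ := hsurj v
      rw [hD1, map_mul, Module.End.mul_apply, hFι, hE, hφF, hφ, map_one, map_zero, add_zero, mul_one]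
  intro w hw
  have h := hs w
  rw [LinearMap.mem_ker.1 hw, map_zero] at h
  exact (Submodule.Quotient.mk_eq_zero Q).1 h.symm
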